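/- Let n ≥ 2 and α = 2/n. There exists a constant c > 0 depending only on n and α such that for all ε > 0, R > 0 and T > 0, writing Ψ(x,t) = (n^{α−1})^{1/α} ( T / ( (|x|² + R² e^{4nt/T}) (t/T+1) ) )^{1/α}, there exists a family of smooth functions ū_1^ε, …, ū_{2n}^ε defined on the region S = { (x,t) : (|x|² + R² e^{4nt/T})^{1/2} < (c/ε) T, 0 ≤ t < T } that is a classical subsolution of the scaled Carleman kinetic system with interaction k_α on S and satisfies (1/(4n)) Ψ ≤ ū_i^ε ≤ (3/(4n)) Ψ on S for every i = 1,…,2n. -/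

import Mathlib

/-- The `2n` velocities: `v_i = e_i` for the first copy of `Fin n` and
`v_{i+n} = −e_i` for the second copy. -/
noncomputable def vel {n : ℕ} : (Fin n ⊕ Fin n) → EuclideanSpace ℝ (Fin n) :=
  Sum.elim (fun i => EuclideanSpace.single i (1 : ℝ))
    (fun i => -EuclideanSpace.single i (1 : ℝ))

/-- The quadratic corrector `1 + a + (n-1)/n² (n a² - D)` multiplying the leading-order profile. -/
noncomputable def corrector (n : ℕ) (D a : ℝ) : ℝ :=
  1 + a + ((n : ℝ) - 1) / (n : ℝ) ^ 2 * (n * a ^ 2 - D)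

theorem abs_one_add_rpow_sub_le {α m : ℝ} (h0 : 0 ≤ α) (h1 : α ≤ 1) (hm : |m| ≤ 1 / 2) :
    |(1 + m) ^ α - (1 + α * m)| ≤ m ^ 2 := by
  obtain ⟨hm1, hm2⟩ := abs_le.1 hm
  have hpos : 0 < 1 + m := by linarith
  have hu : (1 + m) ^ α ≤ 1 + α * m :=
    rpow_one_add_le_one_add_mul_self (by linarith) h0 h1
  have hu' : (1 + m) ^ (1 - α) ≤ 1 + (1 - α) * m :=
    rpow_one_add_le_one_add_mul_self (by linarith) (by linarith) (by linarith)
  have hmul : (1 + m) ^ α * (1 + m) ^ (1 - α) = 1 + m := by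
    rw [← Real.rpow_add hpos]; simp
  have hA : 0 < (1 + m) ^ α := Real.rpow_pos_of_pos hpos _
  have hden : (1 : ℝ) / 2 ≤ 1 + (1 - α) * m := by nlinarith
  have hkey : 1 + m ≤ (1 + m) ^ α * (1 + (1 - α) * m) := by
    calc 1 + m = (1 + m) ^ α * (1 + m) ^ (1 - α) := hmul.symm
      _ ≤ _ := by gcongr
  have hprod : (1 + α * m - m ^ 2) * (1 + (1 - α) * m) ≤ 1 + m := by
    have h4 : α * (1 - α) ≤ 1 / 4 := by nlinarith [sq_nonneg (α - 1 / 2)]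
    have : (1 + α * m - m ^ 2) * (1 + (1 - α) * m)
        = 1 + m + m ^ 2 * (α * (1 - α) - (1 + (1 - α) * m)) := by ring
    nlinarith [sq_nonneg m]
  have hl : 1 + α * m - m ^ 2 ≤ (1 + m) ^ α :=
    le_of_mul_le_mul_right (hprod.trans hkey) (by linarith)
  rw [abs_le]
  constructor <;> nlinarith [sq_nonneg m]

theorem abs_corrector_quadratic_le {n : ℕ} (hn : 2 ≤ n) {a d : ℝ} (ha : |a| ≤ d) :
    |((n : ℝ) - 1) / (n : ℝ) ^ 2 * (n * a ^ 2 - d ^ 2)| ≤ d ^ 2 := by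
  have hn' : (2 : ℝ) ≤ n := by exact_mod_cast hn
  have h2 : a ^ 2 ≤ d ^ 2 := sq_le_sq' (abs_le.1 ha).1 (abs_le.1 ha).2
  have h0 : 0 ≤ a ^ 2 := sq_nonneg a
  have hd : 0 ≤ d ^ 2 := sq_nonneg d
  have hc : ((n : ℝ) - 1) / (n : ℝ) ^ 2 ≤ 1 / n := by
    rw [div_le_div_iff₀ (by positivity) (by positivity)]; nlinarith
  have hc0 : 0 ≤ ((n : ℝ) - 1) / (n : ℝ) ^ 2 := div_nonneg (by linarith) (by positivity)
  have hb : |n * a ^ 2 - d ^ 2| ≤ n * d ^ 2 := by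
    rw [abs_le]; constructor <;> nlinarith
  rw [abs_mul, abs_of_nonneg hc0]
  calc _ ≤ 1 / (n : ℝ) * (n * d ^ 2) := by gcongr
    _ = d ^ 2 := by field_simp

theorem abs_corrector_sub_one_le {n : ℕ} (hn : 2 ≤ n) {a d : ℝ} (ha : |a| ≤ d) (hd : d ≤ 1) :
    |corrector n (d ^ 2) a - 1| ≤ 2 * d := by
  have h := abs_corrector_quadratic_le hn ha
  have h0 : 0 ≤ d := (abs_nonneg a).trans ha
  rw [abs_le] at *
  unfold corrector
  constructor <;> nlinarith

/-- The collision operator applied to the corrector cancels the transport term up to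
a cubic remainder. -/
theorem abs_collision_corrector_le {ι : Type*} [Fintype ι] {n : ℕ} (hn : 2 ≤ n)
    (hcard : (Fintype.card ι : ℝ) = 2 * n) {α d : ℝ} (hα : α = 2 / n) (hd : d ≤ 1 / 4)
    (a : ι → ℝ) (ha : ∀ j, |a j| ≤ d) (hsum : ∑ j, a j = 0) (hsq : ∑ j, a j ^ 2 = 2 * d ^ 2)
    (i : ι) :
    |a i * corrector n (d ^ 2) (a i) + 1 / (2 * n) *
        ∑ j, ((corrector n (d ^ 2) (a i) + corrector n (d ^ 2) (a j)) / 2) ^ α *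
          (corrector n (d ^ 2) (a j) - corrector n (d ^ 2) (a i)) - d ^ 2 / n| ≤ 20 * d ^ 3 := by
  have hn' : (2 : ℝ) ≤ n := by exact_mod_cast hn
  have hn0 : (n : ℝ) ≠ 0 := by positivity
  have h0 : 0 ≤ d := (abs_nonneg _).trans (ha i)
  have hα0 : 0 ≤ α := by rw [hα]; positivity
  have hα1 : α ≤ 1 := by rw [hα, div_le_one (by positivity)]; exact hn'
  set Q : ι → ℝ := fun j => ((n : ℝ) - 1) / (n : ℝ) ^ 2 * (n * a j ^ 2 - d ^ 2) with hQ
  set p : ι → ℝ := fun j => a j + Q j with hp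
  have hP : ∀ j, corrector n (d ^ 2) (a j) = 1 + p j := fun j => by
    simp only [corrector, hp, hQ]; ring
  have hQb : ∀ j, |Q j| ≤ d ^ 2 := fun j => abs_corrector_quadratic_le hn (ha j)
  have hpb : ∀ j, |p j| ≤ 2 * d := fun j => by
    have := abs_corrector_sub_one_le hn (ha j) (by linarith)
    rwa [hP, add_sub_cancel_left] at this
  have hQsum : ∑ j, Q j = 0 := by
    simp only [hQ]
    rw [← Finset.mul_sum, Finset.sum_sub_distrib, ← Finset.mul_sum, hsq]
    simp only [Finset.sum_const, Finset.card_univ, nsmul_eq_mul, hcard]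
    ring
  have hpsum : ∑ j, p j = 0 := by simp only [hp, Finset.sum_add_distrib, hsum, hQsum, add_zero]
  set X : ι → ℝ := fun j => 2 * a j * Q j + Q j ^ 2 with hX
  have haQ : ∀ j, |a j * Q j| ≤ d ^ 3 := fun j => by
    rw [abs_mul]
    calc _ ≤ d * d ^ 2 := mul_le_mul (ha j) (hQb j) (abs_nonneg _) h0
      _ = d ^ 3 := by ring
  have hXb : ∀ j, |X j| ≤ 3 * d ^ 3 := fun j => by
    have h1 := abs_le.1 (haQ j)
    have h2 : Q j ^ 2 ≤ d ^ 3 := by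
      have := sq_le_sq' (abs_le.1 (hQb j)).1 (abs_le.1 (hQb j)).2
      nlinarith [pow_nonneg h0 3]
    have h3 := sq_nonneg (Q j)
    rw [abs_le]; simp only [hX]
    constructor <;> nlinarith
  have hpsq : ∑ j, p j ^ 2 = 2 * d ^ 2 + ∑ j, X j := by
    rw [← hsq, ← Finset.sum_add_distrib]
    exact Finset.sum_congr rfl fun j _ => by simp only [hp, hX]; ring
  set E : ι → ℝ := fun j => ((1 + (p i + p j) / 2) ^ α - (1 + α * ((p i + p j) / 2))) *
    (p j - p i) with hE
  have hEb : ∀ j, |E j| ≤ 16 * d ^ 3 := fun j => by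
    obtain ⟨h1, h2⟩ := abs_le.1 (hpb i)
    obtain ⟨h3, h4⟩ := abs_le.1 (hpb j)
    have hm : |(p i + p j) / 2| ≤ 2 * d := by rw [abs_le]; constructor <;> linarith
    have hR := abs_one_add_rpow_sub_le hα0 hα1 (hm.trans (by linarith))
    have hm2 : ((p i + p j) / 2) ^ 2 ≤ 4 * d ^ 2 := by
      have := sq_le_sq' (abs_le.1 hm).1 (abs_le.1 hm).2
      linarith [this, mul_pow 2 d 2]
    have hs : |p j - p i| ≤ 4 * d := by rw [abs_le]; constructor <;> linarith
    simp only [hE]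
    rw [abs_mul]
    calc _ ≤ (4 * d ^ 2) * (4 * d) :=
          mul_le_mul (hR.trans hm2) hs (abs_nonneg _) (by positivity)
      _ = 16 * d ^ 3 := by ring
  have havg : ∀ (Y : ι → ℝ) (b : ℝ), (∀ j, |Y j| ≤ b) → |1 / (2 * (n : ℝ)) * ∑ j, Y j| ≤ b := by
    intro Y b hY
    rw [abs_mul, abs_of_nonneg (by positivity : (0 : ℝ) ≤ 1 / (2 * n))]
    have : |∑ j, Y j| ≤ 2 * n * b := by
      refine (Finset.abs_sum_le_sum_abs _ _).trans ((Finset.sum_le_sum fun j _ => hY j).trans ?_)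
      simp [hcard]
    calc _ ≤ 1 / (2 * (n : ℝ)) * (2 * n * b) := by gcongr
      _ = b := by field_simp
  have hcoll : ∑ j, ((corrector n (d ^ 2) (a i) + corrector n (d ^ 2) (a j)) / 2) ^ α *
      (corrector n (d ^ 2) (a j) - corrector n (d ^ 2) (a i)) =
      ∑ j, E j - 2 * n * p i + 1 / n * (2 * d ^ 2 + ∑ j, X j - 2 * n * p i ^ 2) := by
    have hterm : ∀ j, ((corrector n (d ^ 2) (a i) + corrector n (d ^ 2) (a j)) / 2) ^ α *
        (corrector n (d ^ 2) (a j) - corrector n (d ^ 2) (a i)) =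
        E j + (p j - p i) + 1 / n * (p j ^ 2 - p i ^ 2) := fun j => by
      have hb : (1 + p i + (1 + p j)) / 2 = 1 + (p i + p j) / 2 := by ring
      have hα2 : (1 : ℝ) / n = α / 2 := by rw [hα]; ring
      rw [hP, hP, hb, hα2]
      simp only [hE]
      ring
    simp only [hterm, Finset.sum_add_distrib, Finset.sum_sub_distrib, ← Finset.mul_sum, hpsum,
      hpsq, Finset.sum_const, Finset.card_univ, nsmul_eq_mul, hcard]
    ring
  have hid : a i * corrector n (d ^ 2) (a i) + 1 / (2 * n) *
      ∑ j, ((corrector n (d ^ 2) (a i) + corrector n (d ^ 2) (a j)) / 2) ^ α *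
        (corrector n (d ^ 2) (a j) - corrector n (d ^ 2) (a i)) - d ^ 2 / n =
      a i * Q i + 1 / (2 * n) * ∑ j, E j + 1 / n * (1 / (2 * n) * ∑ j, X j - X i) := by
    rw [hcoll, hP]
    simp only [hX, hp]
    have hQi : Q i = ((n : ℝ) - 1) / (n : ℝ) ^ 2 * (n * a i ^ 2 - d ^ 2) := rfl
    generalize ∑ j, E j = e
    generalize ∑ j, (2 * a j * Q j + Q j ^ 2) = f
    have : a i * (1 + (a i + Q i)) + 1 / (2 * n) * (e - 2 * n * (a i + Q i) +
        1 / n * (2 * d ^ 2 + f - 2 * n * (a i + Q i) ^ 2)) - d ^ 2 / n -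
        (a i * Q i + 1 / (2 * n) * e + 1 / n * (1 / (2 * n) * f - (2 * a i * Q i + Q i ^ 2)))
        = a i ^ 2 - Q i + 1 / n * (d ^ 2 / n - a i ^ 2) - d ^ 2 / n := by
      field_simp; ring
    rw [← sub_eq_zero, this, hQi]
    field_simp; ring
  rw [hid]
  have h1 := haQ i
  have h2 := havg E _ hEb
  have h3 : |1 / (n : ℝ) * (1 / (2 * n) * ∑ j, X j - X i)| ≤ 3 * d ^ 3 := by
    have h4 : |1 / (2 * (n : ℝ)) * ∑ j, X j - X i| ≤ 6 * d ^ 3 :=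
      (abs_sub _ _).trans (by linarith [havg X _ hXb, hXb i])
    rw [abs_mul, abs_of_nonneg (by positivity : (0 : ℝ) ≤ 1 / n)]
    calc _ ≤ 1 / 2 * (6 * d ^ 3) := by gcongr
      _ = 3 * d ^ 3 := by ring
  exact (abs_add_le _ _).trans (by linarith [abs_add_le (a i * Q i) (1 / (2 * n) * ∑ j, E j)])

theorem neg_collision_le {n : ℕ} (hn : 2 ≤ n) {τ ρ d L B : ℝ}
    (hτ1 : 1 ≤ τ) (hτ2 : τ ≤ 2) (hρ0 : 0 ≤ ρ) (hL : 0 ≤ L) (h0 : 0 ≤ d)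
    (hB : |B - d ^ 2 / n| ≤ 20 * d ^ 3) (hLd : L * d ^ 2 = (n : ℝ) ^ 4 * τ ^ 2 * (1 - ρ)) :
    -(L / (n * τ) * B) ≤ -((n : ℝ) ^ 2 * τ * (1 - ρ)) + 40 * (n : ℝ) ^ 3 * d := by
  have hn' : (2 : ℝ) ≤ n := by exact_mod_cast hn
  have hn0 : (0 : ℝ) < n := by linarith
  have hτ0 : 0 < τ := by linarith
  have hB1 : d ^ 2 / n - 20 * d ^ 3 ≤ B := by linarith [(abs_le.1 hB).1]
  have hLn : 0 ≤ L / (n * τ) := by positivity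
  have h1 : L / (n * τ) * (d ^ 2 / n - 20 * d ^ 3) =
      (n : ℝ) ^ 2 * τ * (1 - ρ) - 20 * (n : ℝ) ^ 3 * d * (τ * (1 - ρ)) := by
    have : L / (n * τ) * (d ^ 2 / n - 20 * d ^ 3) = (L * d ^ 2) * (1 / n - 20 * d) / (n * τ) := by
      ring
    rw [this, hLd]; field_simp
  have h2 := mul_le_mul_of_nonneg_left hB1 hLn
  have h3 : τ * (1 - ρ) ≤ 2 := by nlinarith
  have h4 : (n : ℝ) ^ 3 * d * (τ * (1 - ρ)) ≤ (n : ℝ) ^ 3 * d * 2 := by gcongr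
  rw [h1] at h2
  linarith

/-- Scalar inequality behind the subsolution property, after division by the profile. -/
theorem subsolution_scalar_ineq {n : ℕ} (hn : 2 ≤ n) {τ ρ d L s Q B : ℝ}
    (hτ1 : 1 ≤ τ) (hτ2 : τ ≤ 2) (hρ0 : 0 ≤ ρ) (hρ1 : ρ ≤ 1) (hL : 0 ≤ L)
    (hd : 500 * (n : ℝ) ^ 3 * d ≤ 1) (hs : |s| ≤ d) (hQ : |Q| ≤ d ^ 2)
    (hB : |B - d ^ 2 / n| ≤ 20 * d ^ 3) (hLd : L * d ^ 2 = (n : ℝ) ^ 4 * τ ^ 2 * (1 - ρ)) :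
    (1 + s + Q) * (-(2 * (n : ℝ) ^ 2 * ρ + n / (2 * τ))) + (s + 2 * Q) / τ +
      (n : ℝ) ^ 2 * τ * (1 + 2 * ((n : ℝ) - 1) ^ 2 / (n : ℝ) ^ 2 * s) - L / (n * τ) * B ≤ 0 := by
  have hn' : (2 : ℝ) ≤ n := by exact_mod_cast hn
  have hn0 : (0 : ℝ) < n := by linarith
  have hτ0 : 0 < τ := by linarith
  have h0 : 0 ≤ d := (abs_nonneg _).trans hs
  have hn2 : (4 : ℝ) ≤ (n : ℝ) ^ 2 := by nlinarith
  have hn3 : (2 : ℝ) * (n : ℝ) ^ 2 ≤ (n : ℝ) ^ 3 := by nlinarith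
  have hd1 : d ≤ 1 := by nlinarith
  obtain ⟨hs1, hs2⟩ := abs_le.1 hs
  obtain ⟨hQ1, hQ2⟩ := abs_le.1 hQ
  have hdd : d ^ 2 ≤ d := by nlinarith
  have hcoll := neg_collision_le hn hτ1 hτ2 hρ0 hL h0 hB hLd
  have hτi : (n : ℝ) / 4 ≤ n / (2 * τ) := by
    rw [div_le_div_iff₀ (by norm_num) (by positivity)]; nlinarith
  have hτi2 : (n : ℝ) / (2 * τ) ≤ n / 2 := by
    rw [div_le_div_iff₀ (by positivity) (by norm_num)]; nlinarith
  have hA : (1 + s + Q) * (-(2 * (n : ℝ) ^ 2 * ρ + n / (2 * τ))) ≤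
      -(2 * (n : ℝ) ^ 2 * ρ) - n / 4 + (4 * (n : ℝ) ^ 2 + n) * d := by
    have hM : 2 * (n : ℝ) ^ 2 * ρ + n / (2 * τ) ≤ 2 * (n : ℝ) ^ 2 + n / 2 := by nlinarith
    have hM0 : 0 ≤ 2 * (n : ℝ) ^ 2 * ρ + n / (2 * τ) := by positivity
    have h1 : -(s + Q) ≤ 2 * d := by linarith
    have h2 : -(s + Q) * (2 * (n : ℝ) ^ 2 * ρ + n / (2 * τ)) ≤
        2 * d * (2 * (n : ℝ) ^ 2 + n / 2) :=
      (mul_le_mul_of_nonneg_right h1 hM0).trans (by gcongr)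
    nlinarith
  have hC : (s + 2 * Q) / τ ≤ 3 * d := by
    rw [div_le_iff₀ hτ0]; nlinarith
  have hT : (n : ℝ) ^ 2 * τ * (1 + 2 * ((n : ℝ) - 1) ^ 2 / (n : ℝ) ^ 2 * s) ≤
      (n : ℝ) ^ 2 * τ + 4 * (n : ℝ) ^ 2 * d := by
    have h1 : (n : ℝ) ^ 2 * τ * (1 + 2 * ((n : ℝ) - 1) ^ 2 / (n : ℝ) ^ 2 * s) =
        (n : ℝ) ^ 2 * τ + 2 * τ * ((n : ℝ) - 1) ^ 2 * s := by field_simp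
    have h2 : 2 * τ * ((n : ℝ) - 1) ^ 2 * s ≤ 2 * τ * ((n : ℝ) - 1) ^ 2 * d := by gcongr
    have h3 : 2 * τ * ((n : ℝ) - 1) ^ 2 * d ≤ 2 * 2 * (n : ℝ) ^ 2 * d := by
      gcongr <;> linarith
    linarith
  have hρτ : (n : ℝ) ^ 2 * τ * ρ ≤ 2 * (n : ℝ) ^ 2 * ρ := by
    have : 0 ≤ (n : ℝ) ^ 2 * ρ := by positivity
    nlinarith
  have hn2d := mul_le_mul_of_nonneg_right hn3 h0
  have hnd : 2 * (n : ℝ) * d ≤ (n : ℝ) ^ 2 * d := by gcongr; nlinarith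
  have hdn := mul_le_mul_of_nonneg_right hn' h0
  linarith

theorem hasDerivAt_const_mul_div_rpow {q : ℝ → ℝ} {q' h C T β : ℝ} (hT : 0 < T) (hq : 0 < q h)
    (hd : HasDerivAt q q' h) :
    HasDerivAt (fun s => C * (T / q s) ^ β) (C * (T / q h) ^ β * (-β * q' / q h)) h := by
  have h1 : HasDerivAt (fun s => T / q s) (T * (-q' / q h ^ 2)) h := by
    simpa [div_eq_mul_inv] using (hd.inv hq.ne').const_mul T
  have hpos : 0 < T / q h := by positivity
  refine ((h1.rpow_const (p := β) (Or.inl hpos.ne')).const_mul C).congr_deriv ?_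
  rw [Real.rpow_sub_one hpos.ne']
  field_simp

theorem hasDerivAt_corrector {n : ℕ} {D a : ℝ → ℝ} {D' a' h : ℝ} (hD : HasDerivAt D D' h)
    (ha : HasDerivAt a a' h) :
    HasDerivAt (fun s => corrector n (D s) (a s))
      (a' + ((n : ℝ) - 1) / (n : ℝ) ^ 2 * (2 * n * a h * a' - D')) h := by
  unfold corrector
  refine ((ha.const_add 1).add
    ((((ha.pow 2).const_mul (n : ℝ)).sub hD).const_mul (((n : ℝ) - 1) /
      (n : ℝ) ^ 2))).congr_deriv ?_
  push_cast; ring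

theorem norm_vel {n : ℕ} (i : Fin n ⊕ Fin n) : ‖vel i‖ = 1 := by
  rcases i with i | i <;> simp [vel]

theorem sum_inner_vel {n : ℕ} (x : EuclideanSpace ℝ (Fin n)) : ∑ i, inner ℝ (vel i) x = 0 := by
  simp [vel, Fintype.sum_sum_type]

theorem sum_inner_vel_sq {n : ℕ} (x : EuclideanSpace ℝ (Fin n)) :
    ∑ i, inner ℝ (vel i) x ^ 2 = 2 * ‖x‖ ^ 2 := by
  simp [vel, Fintype.sum_sum_type, EuclideanSpace.real_norm_sq_eq, two_mul,
    EuclideanSpace.inner_single_left]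

/-- The candidate subsolution: leading-order profile times corrector, with velocity `v`. -/
noncomputable def subsolution (n : ℕ) (β C ε R T : ℝ) (v x : EuclideanSpace ℝ (Fin n)) (t : ℝ) :
    ℝ :=
  C * (T / ((‖x‖ ^ 2 + R ^ 2 * Real.exp (4 * n * t / T)) * (t / T + 1))) ^ β *
    corrector n ((ε * n ^ 2 * (t / T + 1) / T) ^ 2 * ‖x‖ ^ 2)
      (ε * n ^ 2 * (t / T + 1) / T * inner ℝ v x)

theorem contDiffAt_subsolution {n : ℕ} {β C ε R T : ℝ} (hR : 0 < R) (hT : 0 < T)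
    (v : EuclideanSpace ℝ (Fin n)) (p : EuclideanSpace ℝ (Fin n) × ℝ) (hp : 0 ≤ p.2)
    (m : WithTop ℕ∞) :
    ContDiffAt ℝ m (fun p : EuclideanSpace ℝ (Fin n) × ℝ =>
      subsolution n β C ε R T v p.1 p.2) p := by
  have hτ : 0 < p.2 / T + 1 := by positivity
  have hq : 0 < (‖p.1‖ ^ 2 + R ^ 2 * Real.exp (4 * n * p.2 / T)) * (p.2 / T + 1) := by positivity
  have hnorm : ContDiffAt ℝ m (fun p : EuclideanSpace ℝ (Fin n) × ℝ => ‖p.1‖ ^ 2) p :=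
    (contDiff_fst.norm_sq ℝ).contDiffAt
  have hinner : ContDiffAt ℝ m (fun p : EuclideanSpace ℝ (Fin n) × ℝ => inner ℝ v p.1) p :=
    contDiffAt_const.inner ℝ contDiffAt_fst
  have hsnd : ContDiffAt ℝ m (fun p : EuclideanSpace ℝ (Fin n) × ℝ => p.2 / T + 1) p :=
    (contDiffAt_snd.div_const T).add contDiffAt_const
  have hden : ContDiffAt ℝ m (fun p : EuclideanSpace ℝ (Fin n) × ℝ =>
      (‖p.1‖ ^ 2 + R ^ 2 * Real.exp (4 * n * p.2 / T)) * (p.2 / T + 1)) p :=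
    (hnorm.add (contDiffAt_const.mul
      ((contDiffAt_const.mul contDiffAt_snd).div_const T).exp)).mul hsnd
  have hκ : ContDiffAt ℝ m (fun p : EuclideanSpace ℝ (Fin n) × ℝ =>
      ε * n ^ 2 * (p.2 / T + 1) / T) p := (contDiffAt_const.mul hsnd).div_const T
  have ha := hκ.mul hinner
  unfold subsolution corrector
  exact (contDiffAt_const.mul ((contDiffAt_const.div hden hq.ne').rpow_const_of_ne
      (div_pos hT hq).ne')).mul
    ((contDiffAt_const.add ha).add (contDiffAt_const.mul
      ((contDiffAt_const.mul (ha.pow 2)).sub ((hκ.pow 2).mul hnorm))))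

theorem hasDerivAt_subsolution_time {n : ℕ} (hn : (n : ℝ) ≠ 0) {β C ε R T t : ℝ}
    (hR : 0 < R) (hT : 0 < T) (ht : 0 ≤ t) (v x : EuclideanSpace ℝ (Fin n)) {q τ s D P ρ : ℝ}
    (hq : q = ‖x‖ ^ 2 + R ^ 2 * Real.exp (4 * n * t / T)) (hτ : τ = t / T + 1)
    (hs : s = ε * n ^ 2 * τ / T * inner ℝ v x) (hD : D = (ε * n ^ 2 * τ / T) ^ 2 * ‖x‖ ^ 2)
    (hP : P = corrector n D s) (hρ : ρ = R ^ 2 * Real.exp (4 * n * t / T) / q) :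
    HasDerivAt (fun r => subsolution n β C ε R T v x r)
      (C * (T / (q * τ)) ^ β / T * (P * (-β * (4 * n * ρ + 1 / τ)) +
        (s + 2 * (((n : ℝ) - 1) / (n : ℝ) ^ 2 * (n * s ^ 2 - D))) / τ)) t := by
  have hτ0 : 0 < τ := by rw [hτ]; positivity
  have hq0 : 0 < q := by rw [hq]; positivity
  have h1 : HasDerivAt (fun r => r / T + 1) (1 / T) t :=
    ((hasDerivAt_id t).div_const T).add_const 1
  have h2 : HasDerivAt (fun r => ‖x‖ ^ 2 + R ^ 2 * Real.exp (4 * n * r / T))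
      (R ^ 2 * (Real.exp (4 * n * t / T) * (4 * n / T))) t := by
    simpa using ((((hasDerivAt_id t).const_mul (4 * (n : ℝ))).div_const T).exp.const_mul
      (R ^ 2)).const_add (‖x‖ ^ 2)
  have h3 := hasDerivAt_const_mul_div_rpow (C := C) (β := β) hT
    (by simp only [Pi.mul_apply]; rw [← hq, ← hτ]; positivity) (h2.mul h1)
  have hκ : HasDerivAt (fun r => ε * n ^ 2 * (r / T + 1) / T) (ε * n ^ 2 * (1 / T) / T) t :=
    (h1.const_mul (ε * (n : ℝ) ^ 2)).div_const T
  have h4 := hasDerivAt_corrector (n := n) ((hκ.pow 2).mul_const (‖x‖ ^ 2))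
    (hκ.mul_const (inner ℝ v x))
  refine (h3.mul h4).congr_deriv ?_
  simp only [Pi.mul_apply, Pi.pow_apply, Nat.cast_ofNat, Nat.add_one_sub_one, pow_one,
    ← hq, ← hτ, ← hs, ← hD, ← hP]
  have hE : R ^ 2 * (Real.exp (4 * n * t / T) * (4 * n / T)) = ρ * q * (4 * n / T) := by
    rw [hρ]; field_simp
  rw [hE]
  generalize (T / (q * τ)) ^ β = Φ
  rw [hs, hD]
  field_simp

theorem fderiv_subsolution_apply {n : ℕ} (hn : (n : ℝ) ≠ 0) {β C ε R T t : ℝ}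
    (hR : 0 < R) (hT : 0 < T) (ht : 0 ≤ t) (v x : EuclideanSpace ℝ (Fin n)) (hv : ‖v‖ = 1) {q τ s D P : ℝ}
    (hq : q = ‖x‖ ^ 2 + R ^ 2 * Real.exp (4 * n * t / T)) (hτ : τ = t / T + 1)
    (hs : s = ε * n ^ 2 * τ / T * inner ℝ v x) (hD : D = (ε * n ^ 2 * τ / T) ^ 2 * ‖x‖ ^ 2)
    (hP : P = corrector n D s) :
    fderiv ℝ (fun y => subsolution n β C ε R T v y t) x v =
      C * (T / (q * τ)) ^ β * (P * (-2 * β * inner ℝ v x / q) +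
        ε * n ^ 2 * τ / T * (1 + 2 * ((n : ℝ) - 1) ^ 2 / (n : ℝ) ^ 2 * s)) := by
  have hτ0 : 0 < τ := by rw [hτ]; positivity
  have hq0 : 0 < q := by rw [hq]; positivity
  have hdiff : DifferentiableAt ℝ (fun y => subsolution n β C ε R T v y t) x := by
    have h := (contDiffAt_subsolution (β := β) (C := C) (ε := ε) hR hT v (x, t) ht
      1).differentiableAt one_ne_zero
    exact h.comp x (f := fun y => (y, t)) (differentiableAt_fun_id.prodMk (differentiableAt_const t))
  rw [← hdiff.lineDeriv_eq_fderiv]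
  refine HasLineDerivAt.lineDeriv ?_
  have hline : HasDerivAt (fun r : ℝ => x + r • v) v 0 := by
    simpa using ((hasDerivAt_id (0 : ℝ)).smul_const v).const_add x
  have hnorm : HasDerivAt (fun r : ℝ => ‖x + r • v‖ ^ 2) (2 * inner ℝ v x) 0 := by
    simpa [real_inner_comm] using hline.norm_sq
  have hinner : HasDerivAt (fun r : ℝ => inner ℝ v (x + r • v)) 1 0 := by
    simpa [hv] using (hasDerivAt_const (0 : ℝ) v).inner ℝ hline
  have h3 := hasDerivAt_const_mul_div_rpow (C := C) (β := β) hT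
    (by simp only [zero_smul, add_zero]; rw [← hq, ← hτ]; positivity)
    ((hnorm.add_const (R ^ 2 * Real.exp (4 * n * t / T))).mul_const (t / T + 1))
  have h4 := hasDerivAt_corrector (n := n)
    (hnorm.const_mul ((ε * n ^ 2 * (t / T + 1) / T) ^ 2))
    (hinner.const_mul (ε * n ^ 2 * (t / T + 1) / T))
  refine (h3.mul h4).congr_deriv ?_
  simp only [zero_smul, add_zero, ← hq, ← hτ, ← hs, ← hD, ← hP]
  generalize (T / (q * τ)) ^ β = Φ
  rw [hs]
  field_simp

theorem profile_rate {n : ℕ} (hn : (0 : ℝ) < n) {α Y : ℝ} (hα : 0 < α) (hY : 0 < Y) :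
    (2 * (((n : ℝ) ^ (α - 1)) ^ (1 / α) / (2 * n) * Y ^ (1 / α))) ^ α = Y / n := by
  have h1 : 2 * (((n : ℝ) ^ (α - 1)) ^ (1 / α) / (2 * n) * Y ^ (1 / α)) =
      ((n : ℝ) ^ (α - 1) * Y) ^ (1 / α) / n := by
    rw [Real.mul_rpow (by positivity) hY.le]
    field_simp
  rw [h1, Real.div_rpow (by positivity) hn.le, ← Real.rpow_mul (by positivity),
    one_div_mul_cancel hα.ne', Real.rpow_one, Real.rpow_sub_one hn.ne']
  field_simp

/-- Existence of a family of local smooth subsolutions in the critical case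
`α = 2/n`, `n ≥ 2`: there is a constant `c > 0` depending only on `n, α`
such that for all `ε, R, T > 0`, writing
`Ψ(x,t) = (n^{α−1})^{1/α}(T/((|x|²+R²e^{4nt/T})(t/T+1)))^{1/α}`, there is a
family `ū_1^ε, …, ū_{2n}^ε`, smooth on the region
`S = {(x,t) : (|x|²+R²e^{4nt/T})^{1/2} < (c/ε)T, 0 ≤ t < T}`, which is a
classical subsolution of the scaled Carleman system with interaction `k_α`
on `S` and satisfies `(1/(4n))Ψ ≤ ū_i^ε ≤ (3/(4n))Ψ` on `S`. -/
theorem exists_local_subsolution_family_critical (n : ℕ) (hn : 2 ≤ n) (α : ℝ)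
    (hα : α = 2 / (n : ℝ)) :
    ∃ c > (0 : ℝ), ∀ (ε R T : ℝ), 0 < ε → 0 < R → 0 < T →
      ∀ Ψ : EuclideanSpace ℝ (Fin n) → ℝ → ℝ,
      (∀ x s, Ψ x s = ((n : ℝ) ^ (α - 1)) ^ (1 / α) *
        (T / ((‖x‖ ^ 2 + R ^ 2 * Real.exp (4 * n * s / T)) * (s / T + 1))) ^ (1 / α)) →
      ∃ u : (Fin n ⊕ Fin n) → EuclideanSpace ℝ (Fin n) → ℝ → ℝ,
        (∀ i, ContDiffOn ℝ (⊤ : ℕ∞) (fun p : EuclideanSpace ℝ (Fin n) × ℝ => u i p.1 p.2)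
          {p : EuclideanSpace ℝ (Fin n) × ℝ |
            (‖p.1‖ ^ 2 + R ^ 2 * Real.exp (4 * n * p.2 / T)) ^ ((1 : ℝ) / 2) <
              (c / ε) * T ∧ 0 ≤ p.2 ∧ p.2 < T}) ∧
        ∀ (x : EuclideanSpace ℝ (Fin n)) (t : ℝ),
          (‖x‖ ^ 2 + R ^ 2 * Real.exp (4 * n * t / T)) ^ ((1 : ℝ) / 2) <
            (c / ε) * T → 0 ≤ t → t < T → ∀ i,
            (deriv (fun s => u i x s) t +
              (1 / ε) * fderiv ℝ (fun y => u i y t) x (vel i) -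
              (1 / (2 * (n : ℝ) * ε ^ 2)) *
                ∑ j, (u i x t + u j x t) ^ α * (u j x t - u i x t) ≤ 0) ∧
            (1 / (4 * (n : ℝ))) * Ψ x t ≤ u i x t ∧
            u i x t ≤ (3 / (4 * (n : ℝ))) * Ψ x t := by
  have hn' : (2 : ℝ) ≤ n := by exact_mod_cast hn
  have hn0 : (0 : ℝ) < n := by linarith
  have hα0 : 0 < α := by rw [hα]; positivity
  have hβ : 1 / α = n / 2 := by rw [hα]; field_simp
  refine ⟨1 / (1000 * (n : ℝ) ^ 5), by positivity, fun ε R T hε hR hT Ψ hΨ => ?_⟩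
  set C : ℝ := ((n : ℝ) ^ (α - 1)) ^ (1 / α) / (2 * n) with hC
  have hC0 : 0 < C := by positivity
  refine ⟨fun i x t => subsolution n (1 / α) C ε R T (vel i) x t, fun i p hp =>
    (contDiffAt_subsolution hR hT _ p hp.2.1 _).contDiffWithinAt, fun x t hS ht0 htT i => ?_⟩
  set q := ‖x‖ ^ 2 + R ^ 2 * Real.exp (4 * n * t / T) with hq
  set τ := t / T + 1 with hτ
  have hτ1 : 1 ≤ τ := by
    have : 0 ≤ t / T := by positivity
    linarith
  have hτ2 : τ ≤ 2 := by
    have : t / T ≤ 1 := (div_le_one hT).2 htT.le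
    linarith
  have hτ0 : 0 < τ := by linarith
  have hq0 : 0 < q := by positivity
  set d := ε * n ^ 2 * τ / T * ‖x‖ with hd
  have hd0 : 0 ≤ d := by positivity
  set a : Fin n ⊕ Fin n → ℝ := fun j => ε * n ^ 2 * τ / T * inner ℝ (vel j) x with ha
  have had : ∀ j, |a j| ≤ d := fun j => by
    rw [ha, hd, abs_mul, abs_of_nonneg (by positivity)]
    gcongr
    simpa [norm_vel] using abs_real_inner_le_norm (vel j) x
  have hasum : ∑ j, a j = 0 := by
    rw [ha, ← Finset.mul_sum, sum_inner_vel, mul_zero]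
  have hasq : ∑ j, a j ^ 2 = 2 * d ^ 2 := by
    simp only [ha, hd, mul_pow]
    rw [← Finset.mul_sum, sum_inner_vel_sq]
    ring
  have hdc : 500 * (n : ℝ) ^ 3 * d ≤ 1 := by
    have hx : ‖x‖ ≤ 1 / (1000 * (n : ℝ) ^ 5) / ε * T := by
      refine le_trans ?_ hS.le
      rw [← Real.sqrt_eq_rpow]
      refine Real.le_sqrt_of_sq_le ?_
      rw [hq]
      have : 0 ≤ R ^ 2 * Real.exp (4 * n * t / T) := by positivity
      linarith
    calc 500 * (n : ℝ) ^ 3 * d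
        ≤ 500 * (n : ℝ) ^ 3 * (ε * n ^ 2 * 2 / T * (1 / (1000 * (n : ℝ) ^ 5) / ε * T)) := by
          rw [hd]; gcongr
      _ = 1 := by field_simp; norm_num
  have hd4 : d ≤ 1 / 4 := by
    have : (8 : ℝ) ≤ (n : ℝ) ^ 3 := by
      calc (8 : ℝ) = 2 ^ 3 := by norm_num
        _ ≤ _ := by gcongr
    nlinarith
  set Y := T / (q * τ) with hY
  have hY0 : 0 < Y := by positivity
  set U := C * Y ^ (1 / α) with hU
  have hU0 : 0 < U := by positivity
  have hUΨ : Ψ x t = 2 * n * U := by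
    rw [hΨ, ← hq, ← hτ, ← hY, hU, hC]; field_simp
  have hu : ∀ j, subsolution n (1 / α) C ε R T (vel j) x t = U * corrector n (d ^ 2) (a j) :=
    fun j => by rw [hd, mul_pow]; rfl
  have hP : ∀ j, 1 / 2 ≤ corrector n (d ^ 2) (a j) ∧ corrector n (d ^ 2) (a j) ≤ 3 / 2 :=
    fun j => by
      obtain ⟨h1, h2⟩ := abs_le.1 (abs_corrector_sub_one_le hn (had j) (by linarith))
      constructor <;> linarith
  have hcoll := abs_collision_corrector_le hn (by simp; ring) hα hd4 a had hasum hasq i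
  set S := ∑ j, ((corrector n (d ^ 2) (a i) + corrector n (d ^ 2) (a j)) / 2) ^ α *
    (corrector n (d ^ 2) (a j) - corrector n (d ^ 2) (a i)) with hSdef
  have hsum : ∑ j, (U * corrector n (d ^ 2) (a i) + U * corrector n (d ^ 2) (a j)) ^ α *
      (U * corrector n (d ^ 2) (a j) - U * corrector n (d ^ 2) (a i)) = Y / n * U * S := by
    rw [hSdef, Finset.mul_sum]
    refine Finset.sum_congr rfl fun j _ => ?_
    have h1 : U * corrector n (d ^ 2) (a i) + U * corrector n (d ^ 2) (a j) =
        (2 * U) * ((corrector n (d ^ 2) (a i) + corrector n (d ^ 2) (a j)) / 2) := by ring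
    rw [h1, Real.mul_rpow (by positivity) (by linarith [(hP i).1, (hP j).1]), hU, hC,
      profile_rate hn0 hα0 hY0]
    ring
  have hDsq : d ^ 2 = (ε * n ^ 2 * τ / T) ^ 2 * ‖x‖ ^ 2 := by rw [hd, mul_pow]
  refine ⟨?_, ?_, ?_⟩
  · have hρ1 : R ^ 2 * Real.exp (4 * n * t / T) / q ≤ 1 := by
      rw [div_le_one hq0, hq]; nlinarith [sq_nonneg ‖x‖]
    have hx : ‖x‖ ^ 2 = q * (1 - R ^ 2 * Real.exp (4 * n * t / T) / q) := by
      rw [mul_sub, mul_div_cancel₀ _ hq0.ne', hq]; ring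
    have hderiv := (hasDerivAt_subsolution_time hn0.ne' (β := 1 / α) (C := C) (ε := ε) hR hT ht0
      (vel i) x hq hτ (s := a i) rfl hDsq rfl rfl).deriv
    have hgrad := fderiv_subsolution_apply hn0.ne' (β := 1 / α) (C := C) (ε := ε) hR hT ht0
      (vel i) x (norm_vel i) hq hτ (s := a i) rfl hDsq rfl
    have hρ0 : 0 ≤ R ^ 2 * Real.exp (4 * n * t / T) / q := by positivity
    set ρ := R ^ 2 * Real.exp (4 * n * t / T) / q with hρ
    have hLd : T ^ 2 / (ε ^ 2 * q) * d ^ 2 = (n : ℝ) ^ 4 * τ ^ 2 * (1 - ρ) := by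
      rw [hDsq, hx]; field_simp
    have hmain := subsolution_scalar_ineq hn hτ1 hτ2 hρ0 hρ1 (by positivity) hdc (had i)
      (abs_corrector_quadratic_le hn (had i)) hcoll hLd
    simp only [hu]
    rw [hderiv, hgrad, hsum, ← hY, ← hU]
    refine le_of_eq_of_le ?_ (mul_nonpos_of_nonneg_of_nonpos (a := U / T) (by positivity) hmain)
    have hinner : inner ℝ (vel i) x = a i * T / (ε * n ^ 2 * τ) := by
      simp only [ha]; field_simp
    rw [hinner, hβ, hY, show (1 + a i + ((n : ℝ) - 1) / (n : ℝ) ^ 2 * (n * a i ^ 2 - d ^ 2)) =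
      corrector n (d ^ 2) (a i) from rfl]
    field_simp
    ring
  · simp only [hu, hUΨ]
    have := mul_le_mul_of_nonneg_left (hP i).1 hU0.le
    refine le_of_eq_of_le ?_ this
    field_simp; norm_num
  · simp only [hu, hUΨ]
    have := mul_le_mul_of_nonneg_left (hP i).2 hU0.le
    refine this.trans_eq ?_
    field_simp; norm_num
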